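/- Let ħ > 0 be real and let Ψ : ℝ³ → ℍ be twice continuously differentiable. Define the momentum operators by (PⱼΨ)(x) = −ħ·ĵ(x)·(∇ⱼΨ)(x) and Qⁱ by (QⁱΨ)(x) = xⁱΨ(x). Then for every x ∈ ℝ³ with x ≠ 0 and all i, j: (i) Qⁱ(PⱼΨ)(x) − Pⱼ(QⁱΨ)(x) = ħ·δⁱⱼ·ĵ(x)·Ψ(x); (ii) Pᵢ(PⱼΨ)(x) − Pⱼ(PᵢΨ)(x) = ħ·ĵ(x)·β_{ij}(x)·Ψ(x), where β_{ij}(x) = (ħ/2)·Σₖ ε_{ijk} xᵏ/|x|³ (the magnetic matrix with eg = ħ/2). -/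

import Mathlib

noncomputable section
open scoped Quaternion
open MeasureTheory

abbrev R3 : Type := EuclideanSpace ℝ (Fin 3)

/-- Levi-Civita symbol on `Fin 3`. -/
def eps (i j k : Fin 3) : ℝ :=
  (((j : ℕ) : ℝ) - ((i : ℕ) : ℝ)) * (((k : ℕ) : ℝ) - ((i : ℕ) : ℝ)) *
    (((k : ℕ) : ℝ) - ((j : ℕ) : ℝ)) / 2

/-- The quaternionic imaginary units 𝔢₁, 𝔢₂, 𝔢₃. -/
def qe : Fin 3 → ℍ[ℝ] := ![⟨0,1,0,0⟩, ⟨0,0,1,0⟩, ⟨0,0,0,1⟩]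

/-- ĵ(z) = (Σₖ zᵏ 𝔢ₖ)/|z|. -/
def jhat (z : R3) : ℍ[ℝ] := ‖z‖⁻¹ • ∑ k, z k • qe k

/-- Partial derivative ∂ᵢ of a quaternion-valued function. -/
def pderiv (i : Fin 3) (Ψ : R3 → ℍ[ℝ]) (x : R3) : ℍ[ℝ] :=
  fderiv ℝ Ψ x (EuclideanSpace.single i 1)

/-- Covariant derivative ∇ᵢ. -/
def cov (i : Fin 3) (Ψ : R3 → ℍ[ℝ]) (x : R3) : ℍ[ℝ] :=
  pderiv i Ψ x + (1/2 : ℝ) • ∑ j, ∑ k, (eps i j k * x j / ‖x‖^2) • (qe k * Ψ x)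

/-- The momentum operator `Pⱼ = −hbar J ∇ⱼ`. -/
def Pop (hbar : ℝ) (j : Fin 3) (Ψ : R3 → ℍ[ℝ]) (x : R3) : ℍ[ℝ] :=
  -hbar • (jhat x * cov j Ψ x)

/-- The connection coefficient `Aᵢ(x) = (1/2) Σ_{j,k} ε_{ijk} xʲ/|x|² 𝔢ₖ`. -/
def conn (i : Fin 3) (x : R3) : ℍ[ℝ] :=
  (‖x‖ ^ 2)⁻¹ • ∑ j, x j • ∑ k, (eps i j k / 2) • qe k

lemma cov_eq (i : Fin 3) (Ψ : R3 → ℍ[ℝ]) (x : R3) :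
    cov i Ψ x = pderiv i Ψ x + conn i x * Ψ x := by
  simp only [cov, conn, Fin.sum_univ_three, smul_add, add_mul, smul_mul_assoc, smul_smul]
  module

lemma pderiv_mul {Φ Ψ : R3 → ℍ[ℝ]} {x : R3} (i : Fin 3) (hΦ : DifferentiableAt ℝ Φ x)
    (hΨ : DifferentiableAt ℝ Ψ x) :
    pderiv i (fun y => Φ y * Ψ y) x = pderiv i Φ x * Ψ x + Φ x * pderiv i Ψ x := by
  simp [pderiv, fderiv_fun_mul' hΦ hΨ, add_comm]

lemma pderiv_add {Φ Ψ : R3 → ℍ[ℝ]} {x : R3} (i : Fin 3) (hΦ : DifferentiableAt ℝ Φ x)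
    (hΨ : DifferentiableAt ℝ Ψ x) :
    pderiv i (fun y => Φ y + Ψ y) x = pderiv i Φ x + pderiv i Ψ x := by
  simp [pderiv, fderiv_fun_add hΦ hΨ]

lemma pderiv_const_smul {Ψ : R3 → ℍ[ℝ]} {x : R3} (i : Fin 3) (c : ℝ)
    (hΨ : DifferentiableAt ℝ Ψ x) :
    pderiv i (fun y => c • Ψ y) x = c • pderiv i Ψ x := by
  simp [pderiv, fderiv_fun_const_smul hΨ]

lemma pderiv_smul {f : R3 → ℝ} {Ψ : R3 → ℍ[ℝ]} {x : R3} (i : Fin 3)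
    (hf : DifferentiableAt ℝ f x) (hΨ : DifferentiableAt ℝ Ψ x) :
    pderiv i (fun y => f y • Ψ y) x =
      f x • pderiv i Ψ x + fderiv ℝ f x (EuclideanSpace.single i 1) • Ψ x := by
  simp [pderiv, fderiv_fun_smul hf hΨ]

lemma fderiv_coord (j : Fin 3) (x v : R3) : fderiv ℝ (fun y : R3 => y j) x v = v j := by
  have h : HasFDerivAt (fun y : R3 => y j) (EuclideanSpace.proj j : R3 →L[ℝ] ℝ) x :=
    (EuclideanSpace.proj j : R3 →L[ℝ] ℝ).hasFDerivAt
  rw [h.fderiv]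
  rfl

lemma pderiv_sum_coord_smul (i : Fin 3) (c : Fin 3 → ℍ[ℝ]) (x : R3) :
    pderiv i (fun y => ∑ k, y k • c k) x = c i := by
  have h (k : Fin 3) : DifferentiableAt ℝ (fun y : R3 => y k • c k) x := by fun_prop
  rw [pderiv, fderiv_fun_sum fun k _ => h k]
  simp only [FunLike.coe_sum, Finset.sum_apply]
  rw [Finset.sum_eq_single i]
  · rw [fderiv_fun_smul (by fun_prop) (by fun_prop)]
    simp [fderiv_coord]
  · intro k _ hk
    rw [fderiv_fun_smul (by fun_prop) (by fun_prop)]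
    simp [fderiv_coord, hk]
  · simp

lemma norm_sq_eq_coords (x : R3) : ‖x‖ ^ 2 = x 0 ^ 2 + x 1 ^ 2 + x 2 ^ 2 := by
  simp [EuclideanSpace.norm_sq_eq, Fin.sum_univ_three]

lemma fderiv_inv_norm_sq {x : R3} (hx : x ≠ 0) (i : Fin 3) :
    fderiv ℝ (fun y : R3 => (‖y‖ ^ 2)⁻¹) x (EuclideanSpace.single i 1) =
      -2 * x i / ‖x‖ ^ 4 := by
  have hn : ‖x‖ ≠ 0 := norm_ne_zero_iff.mpr hx
  have h := (hasDerivAt_inv (pow_ne_zero 2 hn)).comp_hasFDerivAt x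
    (hasStrictFDerivAt_norm_sq x).hasFDerivAt
  refine (DFunLike.congr_fun h.fderiv _).trans ?_
  simp [EuclideanSpace.inner_single_right]
  field_simp

lemma differentiableAt_inv_norm {x : R3} (hx : x ≠ 0) :
    DifferentiableAt ℝ (fun y : R3 => ‖y‖⁻¹) x :=
  (differentiableAt_id.norm ℝ hx).fun_inv (norm_ne_zero_iff.mpr hx)

lemma differentiableAt_inv_norm_sq {x : R3} (hx : x ≠ 0) :
    DifferentiableAt ℝ (fun y : R3 => (‖y‖ ^ 2)⁻¹) x :=
  ((differentiableAt_id.norm ℝ hx).fun_pow 2).fun_inv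
    (pow_ne_zero 2 (norm_ne_zero_iff.mpr hx))

lemma fderiv_inv_norm {x : R3} (hx : x ≠ 0) (i : Fin 3) :
    fderiv ℝ (fun y : R3 => ‖y‖⁻¹) x (EuclideanSpace.single i 1) = -x i / ‖x‖ ^ 3 := by
  have hn : ‖x‖ ≠ 0 := norm_ne_zero_iff.mpr hx
  have h := fderiv_inv_norm_sq hx i
  have e : (fun y : R3 => (‖y‖ ^ 2)⁻¹) = fun y => ‖y‖⁻¹ * ‖y‖⁻¹ := by
    funext y
    rw [sq, mul_inv]
  rw [e, fderiv_fun_mul (differentiableAt_inv_norm hx) (differentiableAt_inv_norm hx)] at h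
  simp only [add_apply, smul_apply, smul_eq_mul] at h
  field_simp at h ⊢
  linarith

lemma differentiableAt_jhat {x : R3} (hx : x ≠ 0) : DifferentiableAt ℝ jhat x :=
  (differentiableAt_inv_norm hx).fun_smul (by fun_prop)

lemma differentiableAt_conn {x : R3} (hx : x ≠ 0) (i : Fin 3) :
    DifferentiableAt ℝ (conn i) x :=
  (differentiableAt_inv_norm_sq hx).fun_smul (by fun_prop)

lemma pderiv_jhat {x : R3} (hx : x ≠ 0) (i : Fin 3) :
    pderiv i jhat x = ‖x‖⁻¹ • qe i + (-x i / ‖x‖ ^ 3) • ∑ k, x k • qe k := by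
  have h := pderiv_smul (Ψ := fun y => ∑ k, y k • qe k) i (differentiableAt_inv_norm hx)
    (by fun_prop)
  rw [fderiv_inv_norm hx, pderiv_sum_coord_smul] at h
  exact h

lemma pderiv_conn {x : R3} (hx : x ≠ 0) (i j : Fin 3) :
    pderiv i (conn j) x = (‖x‖ ^ 2)⁻¹ • ∑ k, (eps j i k / 2) • qe k +
      (-2 * x i / ‖x‖ ^ 4) • ∑ l, x l • ∑ k, (eps j l k / 2) • qe k := by
  have h := pderiv_smul (Ψ := fun y => ∑ l, y l • ∑ k, (eps j l k / 2) • qe k) i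
    (differentiableAt_inv_norm_sq hx) (by fun_prop)
  rw [fderiv_inv_norm_sq hx, pderiv_sum_coord_smul] at h
  exact h

/-- The imaginary quaternion with the given components. -/
def imagQuat (c : Fin 3 → ℝ) : ℍ[ℝ] := ⟨0, c 0, c 1, c 2⟩

lemma re_imagQuat (c : Fin 3 → ℝ) : (imagQuat c).re = 0 := rfl

lemma imI_imagQuat (c : Fin 3 → ℝ) : (imagQuat c).imI = c 0 := rfl

lemma imJ_imagQuat (c : Fin 3 → ℝ) : (imagQuat c).imJ = c 1 := rfl

lemma imK_imagQuat (c : Fin 3 → ℝ) : (imagQuat c).imK = c 2 := rfl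

lemma smul_imagQuat (r : ℝ) (c : Fin 3 → ℝ) : r • imagQuat c = imagQuat fun k => r * c k := by
  ext <;> simp [re_imagQuat, imI_imagQuat, imJ_imagQuat, imK_imagQuat]

lemma imagQuat_add (c d : Fin 3 → ℝ) :
    imagQuat c + imagQuat d = imagQuat fun k => c k + d k := by
  ext <;> simp [re_imagQuat, imI_imagQuat, imJ_imagQuat, imK_imagQuat]

lemma qe_eq_imagQuat (i : Fin 3) : qe i = imagQuat fun k => if k = i then 1 else 0 := by
  fin_cases i <;> ext <;> simp [qe, imagQuat]

lemma sum_smul_qe (c : Fin 3 → ℝ) : ∑ k, c k • qe k = imagQuat c := by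
  simp only [Fin.sum_univ_three, qe_eq_imagQuat, smul_imagQuat, imagQuat_add]
  ext <;> simp [imagQuat]

lemma jhat_eq_imagQuat (x : R3) : jhat x = imagQuat fun k => ‖x‖⁻¹ * x k := by
  rw [jhat, sum_smul_qe, smul_imagQuat]

lemma eps_eq (i j k : Fin 3) : eps i j k =
    ![![![0, 0, 0], ![0, 0, 1], ![0, -1, 0]], ![![0, 0, -1], ![0, 0, 0], ![1, 0, 0]],
      ![![0, 1, 0], ![-1, 0, 0], ![0, 0, 0]]] i j k := by
  fin_cases i <;> fin_cases j <;> fin_cases k <;> norm_num [eps]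

lemma conn_eq_imagQuat (i : Fin 3) (x : R3) :
    conn i x = imagQuat fun k =>
      (‖x‖ ^ 2)⁻¹ * (x 0 * (eps i 0 k / 2) + x 1 * (eps i 1 k / 2) + x 2 * (eps i 2 k / 2)) := by
  simp only [conn, sum_smul_qe]
  simp only [Fin.sum_univ_three, smul_imagQuat, imagQuat_add]

lemma jhat_mul_self {x : R3} (hx : x ≠ 0) : jhat x * jhat x = -1 := by
  have hn : ‖x‖ ≠ 0 := norm_ne_zero_iff.mpr hx
  have hr := norm_sq_eq_coords x
  rw [jhat_eq_imagQuat]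
  ext <;> simp [re_imagQuat, imI_imagQuat, imJ_imagQuat, imK_imagQuat] <;> field_simp <;>
    linarith

/-- `ĵ` is covariantly constant. -/
lemma pderiv_jhat_add_conn_mul {x : R3} (hx : x ≠ 0) (i : Fin 3) :
    pderiv i jhat x + conn i x * jhat x = jhat x * conn i x := by
  have hn : ‖x‖ ≠ 0 := norm_ne_zero_iff.mpr hx
  have hr := norm_sq_eq_coords x
  rw [pderiv_jhat hx, sum_smul_qe, qe_eq_imagQuat, jhat_eq_imagQuat, conn_eq_imagQuat]
  fin_cases i <;> ext <;>
    simp [re_imagQuat, imI_imagQuat, imJ_imagQuat, imK_imagQuat, eps_eq] <;> field_simp <;>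
    (try simp only [hr]) <;> ring

/-- The curvature of the connection. -/
lemma curvature_eq {x : R3} (hx : x ≠ 0) (i j : Fin 3) :
    pderiv i (conn j) x - pderiv j (conn i) x + (conn i x * conn j x - conn j x * conn i x) =
      (-(1 / 2) * ∑ k, eps i j k * x k / ‖x‖ ^ 3) • jhat x := by
  have hn : ‖x‖ ≠ 0 := norm_ne_zero_iff.mpr hx
  have hr := norm_sq_eq_coords x
  rw [pderiv_conn hx, pderiv_conn hx]
  simp only [sum_smul_qe, jhat_eq_imagQuat, conn_eq_imagQuat]
  simp only [Fin.sum_univ_three, smul_imagQuat, imagQuat_add]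
  fin_cases i <;> fin_cases j <;> ext <;>
    simp [re_imagQuat, imI_imagQuat, imJ_imagQuat, imK_imagQuat, eps_eq] <;> field_simp <;>
    (try simp only [hr]) <;> ring

lemma pderiv_eq_fderiv_apply (j : Fin 3) (Ψ : R3 → ℍ[ℝ]) :
    pderiv j Ψ = fun y => fderiv ℝ Ψ y (EuclideanSpace.single j 1) := rfl

lemma differentiable_pderiv {Ψ : R3 → ℍ[ℝ]} (hΨ : ContDiff ℝ 2 Ψ) (j : Fin 3) :
    Differentiable ℝ (pderiv j Ψ) := by
  have h : Differentiable ℝ (fderiv ℝ Ψ) :=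
    (hΨ.fderiv_right (m := 1) (by norm_num)).differentiable (by norm_num)
  rw [pderiv_eq_fderiv_apply]
  fun_prop

lemma pderiv_comm {Ψ : R3 → ℍ[ℝ]} (hΨ : ContDiff ℝ 2 Ψ) (i j : Fin 3) (x : R3) :
    pderiv i (pderiv j Ψ) x = pderiv j (pderiv i Ψ) x := by
  have h : DifferentiableAt ℝ (fderiv ℝ Ψ) x :=
    (hΨ.fderiv_right (m := 1) (by norm_num)).differentiable (by norm_num) x
  have key (i j : Fin 3) : pderiv i (pderiv j Ψ) x =
      fderiv ℝ (fderiv ℝ Ψ) x (EuclideanSpace.single i 1) (EuclideanSpace.single j 1) := by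
    rw [pderiv, pderiv_eq_fderiv_apply, fderiv_clm_apply h (by fun_prop)]
    simp
  rw [key, key]
  exact (hΨ.contDiffAt.isSymmSndFDerivAt (by simp)) _ _

lemma differentiableAt_cov {Ψ : R3 → ℍ[ℝ]} (hΨ : ContDiff ℝ 2 Ψ) {x : R3} (hx : x ≠ 0)
    (j : Fin 3) : DifferentiableAt ℝ (cov j Ψ) x := by
  have e : cov j Ψ = fun y => pderiv j Ψ y + conn j y * Ψ y := funext fun y => cov_eq j Ψ y
  rw [e]
  exact (differentiable_pderiv hΨ j x).fun_add
    ((differentiableAt_conn hx j).fun_mul (hΨ.differentiable (by norm_num) x))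

lemma cov_cov {Ψ : R3 → ℍ[ℝ]} (hΨ : ContDiff ℝ 2 Ψ) {x : R3} (hx : x ≠ 0) (i j : Fin 3) :
    cov i (cov j Ψ) x = pderiv i (pderiv j Ψ) x +
      (pderiv i (conn j) x * Ψ x + conn j x * pderiv i Ψ x) +
      conn i x * (pderiv j Ψ x + conn j x * Ψ x) := by
  have e : cov j Ψ = fun y => pderiv j Ψ y + conn j y * Ψ y := funext fun y => cov_eq j Ψ y
  have hd : DifferentiableAt ℝ Ψ x := hΨ.differentiable (by norm_num) x
  rw [cov_eq, e, pderiv_add i (differentiable_pderiv hΨ j x)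
    ((differentiableAt_conn hx j).fun_mul hd), pderiv_mul i (differentiableAt_conn hx j) hd]

lemma cov_commutator {Ψ : R3 → ℍ[ℝ]} (hΨ : ContDiff ℝ 2 Ψ) {x : R3} (hx : x ≠ 0)
    (i j : Fin 3) :
    cov i (cov j Ψ) x - cov j (cov i Ψ) x =
      (-(1 / 2) * ∑ k, eps i j k * x k / ‖x‖ ^ 3) • (jhat x * Ψ x) := by
  rw [← smul_mul_assoc, ← curvature_eq hx, cov_cov hΨ hx, cov_cov hΨ hx, pderiv_comm hΨ i j]
  noncomm_ring

/-- Since `ĵ` is covariantly constant and squares to `-1`, `Pᵢ Pⱼ = -ħ² ∇ᵢ ∇ⱼ`. -/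
lemma Pop_Pop (hbar : ℝ) {Ψ : R3 → ℍ[ℝ]} (hΨ : ContDiff ℝ 2 Ψ) {x : R3} (hx : x ≠ 0)
    (i j : Fin 3) :
    Pop hbar i (fun y => Pop hbar j Ψ y) x = -hbar ^ 2 • cov i (cov j Ψ) x := by
  have hJ := differentiableAt_jhat hx
  have hC := differentiableAt_cov hΨ hx j
  have key : cov i (fun y => Pop hbar j Ψ y) x = -hbar • (jhat x * cov i (cov j Ψ) x) := by
    simp only [Pop]
    rw [cov_eq, pderiv_const_smul i _ (hJ.fun_mul hC), pderiv_mul i hJ hC, cov_eq i (cov j Ψ),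
      mul_smul_comm, ← smul_add, mul_add, ← mul_assoc (jhat x) (conn i x),
      ← pderiv_jhat_add_conn_mul hx]
    congr 1
    noncomm_ring
  rw [Pop, key, mul_smul_comm, ← mul_assoc, jhat_mul_self hx, smul_smul, neg_one_mul, smul_neg,
    ← neg_smul]
  congr 1
  ring

lemma cov_coord_smul {Ψ : R3 → ℍ[ℝ]} {x : R3} (hΨ : DifferentiableAt ℝ Ψ x) (i j : Fin 3) :
    cov j (fun y => y i • Ψ y) x = x i • cov j Ψ x + (if i = j then (1 : ℝ) else 0) • Ψ x := by
  rw [cov_eq, cov_eq, pderiv_smul j (by fun_prop) hΨ, fderiv_coord, PiLp.single_apply,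
    mul_smul_comm, smul_add]
  abel

/-- the commutation relations `[Qⁱ,Pⱼ] = hbarJδⁱⱼ` and `[Pᵢ,Pⱼ] = hbarJβᵢⱼ`
with `βᵢⱼ(x) = (hbar/2) Σₖ ε_{ijk} xᵏ/|x|³`. -/
theorem stmt11 (hbar : ℝ) (hh : 0 < hbar) (Ψ : R3 → ℍ[ℝ]) (hΨ : ContDiff ℝ 2 Ψ)
    (x : R3) (hx : x ≠ 0) (i j : Fin 3) :
    (x i • Pop hbar j Ψ x - Pop hbar j (fun y => y i • Ψ y) x
        = (hbar * (if i = j then (1:ℝ) else 0)) • (jhat x * Ψ x)) ∧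
    (Pop hbar i (fun y => Pop hbar j Ψ y) x - Pop hbar j (fun y => Pop hbar i Ψ y) x
        = hbar • (jhat x * ((hbar/2 * ∑ k, eps i j k * x k / ‖x‖^3) • Ψ x))) := by
  refine ⟨?_, ?_⟩
  · rw [Pop, Pop, cov_coord_smul (hΨ.differentiable (by norm_num) x), mul_add, mul_smul_comm,
      mul_smul_comm]
    module
  · rw [Pop_Pop hbar hΨ hx, Pop_Pop hbar hΨ hx, ← smul_sub, cov_commutator hΨ hx, mul_smul_comm,
      smul_smul, smul_smul]
    congr 1
    ring
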